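/- Let ψ : ℝ → ℝ be twice continuously differentiable with bounded first and second derivatives, let h ∈ ℝ with ψ′(h) ≠ 0, let λ ∈ ℝ and q ∈ [−1,1]. Let Z₁, Z₂ be independent standard Gaussian random variables and set X = Z₁ and Y = q·Z₁ + √(1−q²)·Z₂ (so (X,Y) is a centered Gaussian pair with unit variances and covariance q). For T ∈ ℕ set β_T = λ/(|ψ′(h)|·√T). Then lim_{T→∞} T · E[(ψ(β_T X + h) − ψ(h))·(ψ(β_T Y + h) − ψ(h))] = λ²·q. -/

import Mathlib

open MeasureTheory ProbabilityTheory Filter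

theorem HasDerivAt.tendsto_sqrt_mul_sub {f : ℝ → ℝ} {f' a : ℝ} (hf : HasDerivAt f f' a) (c : ℝ) :
    Tendsto (fun T : ℕ => Real.sqrt T * (f (c / Real.sqrt T + a) - f a)) atTop
      (nhds (f' * c)) := by
  have hg : HasDerivAt (fun s : ℝ => f (c * s + a)) (f' * c) 0 := by
    have hlin : HasDerivAt (fun s : ℝ => c * s + a) c 0 := by
      simpa using ((hasDerivAt_id (0 : ℝ)).const_mul c).add_const a
    exact HasDerivAt.comp (h₂ := f) 0 (by simpa using hf) hlin
  have hT : Tendsto (fun T : ℕ => (Real.sqrt T)⁻¹) atTop (nhdsWithin 0 {0}ᶜ) := by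
    refine tendsto_nhdsWithin_iff.2 ⟨?_, ?_⟩
    · exact tendsto_inv_atTop_zero.comp
        (Real.tendsto_sqrt_atTop.comp tendsto_natCast_atTop_atTop)
    · filter_upwards [eventually_gt_atTop 0] with T hT
      have : (0 : ℝ) < T := by exact_mod_cast hT
      simp only [Set.mem_compl_iff, Set.mem_singleton_iff]
      positivity
  refine (hg.tendsto_slope_zero.comp hT).congr fun T => ?_
  simp [div_eq_mul_inv]

theorem abs_sqrt_mul_sub_le {f : ℝ → ℝ} {M : ℝ} (hf : Differentiable ℝ f)
    (hM : ∀ x, |deriv f x| ≤ M) (a c : ℝ) (T : ℕ) :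
    |Real.sqrt T * (f (c / Real.sqrt T + a) - f a)| ≤ M * |c| := by
  have hM0 : 0 ≤ M := (abs_nonneg _).trans (hM 0)
  rcases Nat.eq_zero_or_pos T with rfl | hT
  · simpa using mul_nonneg hM0 (abs_nonneg c)
  have hs : 0 < Real.sqrt T := Real.sqrt_pos.2 (by exact_mod_cast hT)
  have key := Convex.norm_image_sub_le_of_norm_deriv_le (f := f) (s := Set.univ)
    (fun x _ => hf x) (fun x _ => hM x) convex_univ (Set.mem_univ a)
    (Set.mem_univ (c / Real.sqrt T + a))
  rw [add_sub_cancel_right, Real.norm_eq_abs, Real.norm_eq_abs, abs_div, abs_of_pos hs] at key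
  rw [abs_mul, abs_of_pos hs]
  calc _ ≤ Real.sqrt T * (M * (|c| / Real.sqrt T)) := by gcongr
    _ = M * |c| := by field_simp

theorem memLp_fst_gaussianReal_prod :
    MemLp (fun z : ℝ × ℝ => z.1) 2 ((gaussianReal 0 1).prod (gaussianReal 0 1)) :=
  (memLp_id_gaussianReal 2).comp_fst _

theorem memLp_snd_gaussianReal_prod :
    MemLp (fun z : ℝ × ℝ => z.2) 2 ((gaussianReal 0 1).prod (gaussianReal 0 1)) :=
  (memLp_id_gaussianReal 2).comp_snd _

theorem integral_sq_gaussianReal_zero_one : ∫ x, x ^ 2 ∂gaussianReal 0 1 = 1 := by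
  have hv := variance_of_integral_eq_zero (μ := gaussianReal 0 1) (X := id)
    aemeasurable_id (by simp)
  simpa [variance_id_gaussianReal] using hv.symm

theorem integral_fst_mul_linear_gaussianReal_prod (a b : ℝ) :
    ∫ z : ℝ × ℝ, z.1 * (a * z.1 + b * z.2) ∂((gaussianReal 0 1).prod (gaussianReal 0 1)) = a := by
  have h1 : Integrable (fun z : ℝ × ℝ => z.1 ^ 2)
      ((gaussianReal 0 1).prod (gaussianReal 0 1)) := memLp_fst_gaussianReal_prod.integrable_sq
  have h2 : Integrable (fun z : ℝ × ℝ => z.1 * z.2)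
      ((gaussianReal 0 1).prod (gaussianReal 0 1)) :=
    memLp_fst_gaussianReal_prod.integrable_mul memLp_snd_gaussianReal_prod
  have e1 : ∫ z : ℝ × ℝ, z.1 ^ 2 ∂((gaussianReal 0 1).prod (gaussianReal 0 1)) = 1 := by
    rw [integral_fun_fst (fun x : ℝ => x ^ 2)]
    simp [integral_sq_gaussianReal_zero_one]
  have e2 : ∫ z : ℝ × ℝ, z.1 * z.2 ∂((gaussianReal 0 1).prod (gaussianReal 0 1)) = 0 := by
    rw [integral_prod_mul (fun x : ℝ => x) (fun y : ℝ => y)]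
    simp
  calc _ = ∫ z : ℝ × ℝ, (a * z.1 ^ 2 + b * (z.1 * z.2))
        ∂((gaussianReal 0 1).prod (gaussianReal 0 1)) := by
        congr 1 with z; ring
    _ = a := by
      rw [integral_add (h1.const_mul a) (h2.const_mul b), integral_const_mul, integral_const_mul,
        e1, e2]
      ring

/-- **The effective-covariance computation** (proof of Lemma B.1, reduction to the linear case).
For `ψ ∈ C²` with bounded first and second derivatives, `ψ'(h) ≠ 0`, and a centered Gaussian pair
`(X,Y) = (Z₁, q Z₁ + √(1-q²) Z₂)` with unit variances and covariance `q`, under the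
central-limit scaling `β_T = λ/(|ψ'(h)| √T)` one has
`lim_{T→∞} T · E[(ψ(β_T X + h) − ψ(h))(ψ(β_T Y + h) − ψ(h))] = λ² q`. -/
theorem effective_covariance_limit
    (ψ : ℝ → ℝ) (hψ : ContDiff ℝ 2 ψ)
    (M : ℝ) (hψ' : ∀ x, |deriv ψ x| ≤ M) (hψ'' : ∀ x, |deriv (deriv ψ) x| ≤ M)
    (h : ℝ) (hh : deriv ψ h ≠ 0)
    (lam : ℝ) (q : ℝ) (hq : q ∈ Set.Icc (-1 : ℝ) 1) :
    Tendsto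
      (fun T : ℕ => (T : ℝ) *
        ∫ z : ℝ × ℝ,
          (ψ (lam / (|deriv ψ h| * Real.sqrt T) * z.1 + h) - ψ h) *
          (ψ (lam / (|deriv ψ h| * Real.sqrt T) *
              (q * z.1 + Real.sqrt (1 - q ^ 2) * z.2) + h) - ψ h)
          ∂((gaussianReal 0 1).prod (gaussianReal 0 1)))
      atTop (nhds (lam ^ 2 * q)) := by
  have hd : Differentiable ℝ ψ := hψ.differentiable (by norm_num)
  have hcont : Continuous ψ := hψ.continuous
  set k : ℝ := lam / |deriv ψ h| with hk
  have hdk : (deriv ψ h * k) ^ 2 = lam ^ 2 := by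
    rw [hk, mul_pow, div_pow, sq_abs]
    field_simp
  set X : ℝ × ℝ → ℝ := fun z => z.1
  set Y : ℝ × ℝ → ℝ := fun z => q * z.1 + Real.sqrt (1 - q ^ 2) * z.2
  have hXY : Integrable (fun z => X z * Y z) ((gaussianReal 0 1).prod (gaussianReal 0 1)) :=
    memLp_fst_gaussianReal_prod.integrable_mul
      ((memLp_fst_gaussianReal_prod.const_mul q).add
        (memLp_snd_gaussianReal_prod.const_mul (Real.sqrt (1 - q ^ 2))))
  have hlim : ∫ z, lam ^ 2 * (X z * Y z) ∂((gaussianReal 0 1).prod (gaussianReal 0 1)) =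
      lam ^ 2 * q := by
    rw [integral_const_mul, integral_fst_mul_linear_gaussianReal_prod]
  rw [← hlim]
  have hscale (T : ℕ) (x : ℝ) :
      lam / (|deriv ψ h| * Real.sqrt T) * x = k * x / Real.sqrt T := by
    rw [hk, ← div_div]; ring
  simp only [← integral_const_mul, hscale]
  have hsplit (T : ℕ) (u v : ℝ) :
      (T : ℝ) * (u * v) = (Real.sqrt T * u) * (Real.sqrt T * v) := by
    rw [mul_mul_mul_comm, Real.mul_self_sqrt T.cast_nonneg]
  simp only [hsplit]
  refine tendsto_integral_of_dominated_convergence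
    (fun z => (M * |k|) ^ 2 * |X z * Y z|) (fun T => ?_) (hXY.abs.const_mul _)
    (fun T => .of_forall fun z => ?_) (.of_forall fun z => ?_)
  · exact Continuous.aestronglyMeasurable (by fun_prop)
  · have hX := abs_sqrt_mul_sub_le hd hψ' h (k * X z) T
    have hY := abs_sqrt_mul_sub_le hd hψ' h (k * Y z) T
    rw [Real.norm_eq_abs, abs_mul]
    refine (mul_le_mul hX hY (abs_nonneg _) ((abs_nonneg _).trans hX)).trans_eq ?_
    simp only [abs_mul]
    ring
  · have hX := hd.differentiableAt.hasDerivAt.tendsto_sqrt_mul_sub (a := h) (k * X z)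
    have hY := hd.differentiableAt.hasDerivAt.tendsto_sqrt_mul_sub (a := h) (k * Y z)
    convert hX.mul hY using 2
    rw [← hdk]
    ring
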